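/- arXiv:2212.04171 — 4 statements merged into one kernel-verified Lean document; each statement's English description precedes it below -/
import Mathlib

section
/- For every linear pattern t (a term in which each variable occurs at most once), image disjointness together with pattern injectivity for t implies the pattern requirement for t: for every substitution σ with tσ ground and every ground term m, if γ(tσ) = γ(m) then there exists a substitution σ' with m =_E tσ'. -/
/-- Terms over a signature `Sig` of function symbols, with variables (indexed
by `ℕ`) and fresh/public names (the set of names `N = fresh ∪ pub`). -/
inductive Tm (Sig : Type) : Type
  | var : ℕ → Tm Sig
  | frsh : ℕ → Tm Sig
  | pub : ℕ → Tm Sig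
  | app : Sig → List (Tm Sig) → Tm Sig

/-- Applying a substitution to a term. -/
def Tm.subst {Sig : Type} (θ : ℕ → Tm Sig) : Tm Sig → Tm Sig
  | .var v => θ v
  | .frsh n => .frsh n
  | .pub n => .pub n
  | .app f ts => .app f (ts.attach.map (fun x => Tm.subst θ x.1))
decreasing_by
  simp_wf
  have := List.sizeOf_lt_of_mem x.2
  omega

/-- Ground terms: terms without variables. -/
inductive Tm.IsGround {Sig : Type} : Tm Sig → Prop
  | frsh (n : ℕ) : IsGround (.frsh n)
  | pub (n : ℕ) : IsGround (.pub n)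
  | app (f : Sig) (ts : List (Tm Sig)) : (∀ t ∈ ts, IsGround t) → IsGround (.app f ts)

/-- A substitution maps every variable to a ground term. -/
def GroundSubst {Sig : Type} (θ : ℕ → Tm Sig) : Prop := ∀ v, (θ v).IsGround

/-- `t` is a name (a fresh or public name). -/
def Tm.IsName {Sig : Type} (t : Tm Sig) : Prop :=
  (∃ k, t = Tm.frsh k) ∨ (∃ k, t = Tm.pub k)

/-- The subterm relation. -/
inductive Subtm {Sig : Type} : Tm Sig → Tm Sig → Prop
  | refl (t : Tm Sig) : Subtm t t
  | app {t u : Tm Sig} {f : Sig} {ts : List (Tm Sig)} :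
      u ∈ ts → Subtm t u → Subtm t (.app f ts)

/-- The list of variable occurrences of a term. -/
def Tm.varsList {Sig : Type} : Tm Sig → List ℕ
  | .var v => [v]
  | .frsh _ => []
  | .pub _ => []
  | .app _ ts => (ts.attach.map (fun x => Tm.varsList x.1)).flatten
decreasing_by
  simp_wf
  have := List.sizeOf_lt_of_mem x.2
  omega

/-- A pattern is linear if every variable occurs at most once in it. -/
def Tm.Linear {Sig : Type} (t : Tm Sig) : Prop := t.varsList.Nodup

@[elab_as_elim]
theorem Tm.induction {Sig : Type} {P : Tm Sig → Prop} (var : ∀ v, P (.var v))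
    (frsh : ∀ n, P (.frsh n)) (pub : ∀ n, P (.pub n))
    (app : ∀ f ts, (∀ t ∈ ts, P t) → P (.app f ts)) : ∀ t, P t
  | .var v => var v
  | .frsh n => frsh n
  | .pub n => pub n
  | .app f ts => app f ts fun t _ => Tm.induction var frsh pub app t
decreasing_by
  simp_wf
  have := List.sizeOf_lt_of_mem ‹t ∈ ts›
  omega

theorem Tm.subst_app {Sig : Type} (θ : ℕ → Tm Sig) (f : Sig) (ts : List (Tm Sig)) :
    (Tm.app f ts).subst θ = .app f (ts.map (Tm.subst θ)) := by
  rw [Tm.subst]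
  simp

theorem Tm.varsList_app {Sig : Type} (f : Sig) (ts : List (Tm Sig)) :
    (Tm.app f ts).varsList = (ts.map Tm.varsList).flatten := by
  rw [Tm.varsList]
  simp

theorem Tm.subst_congr {Sig : Type} {θ η : ℕ → Tm Sig} {t : Tm Sig}
    (h : ∀ v ∈ t.varsList, θ v = η v) : t.subst θ = t.subst η := by
  induction t using Tm.induction with
  | var v => simpa [Tm.subst, Tm.varsList] using h
  | frsh n => simp [Tm.subst]
  | pub n => simp [Tm.subst]
  | app f ts ih =>
    rw [Tm.subst_app, Tm.subst_app]
    congr 1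
    refine List.map_congr_left fun t ht => ih t ht fun v hv => h v ?_
    rw [Tm.varsList_app]
    exact List.mem_flatten_of_mem (List.mem_map_of_mem ht) hv

/-- Substitutions chosen separately for terms with pairwise disjoint variables can be merged
into a single one. -/
theorem exists_groundSubst_forall₂ {Sig : Type} {R : Tm Sig → Tm Sig → Prop}
    {us ts : List (Tm Sig)} (hlin : (ts.map Tm.varsList).flatten.Nodup)
    (h : List.Forall₂ (fun u t => ∃ σ, GroundSubst σ ∧ R u (t.subst σ)) us ts) :
    ∃ σ, GroundSubst σ ∧ List.Forall₂ R us (ts.map (Tm.subst σ)) := by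
  classical
  induction h with
  | nil => exact ⟨fun _ => .frsh 0, fun _ => .frsh 0, by simp⟩
  | @cons u t us ts hut _ ih =>
    rw [List.map_cons, List.flatten_cons, List.nodup_append'] at hlin
    obtain ⟨-, hts, hdisj⟩ := hlin
    obtain ⟨σ₁, hσ₁, hu⟩ := hut
    obtain ⟨σ₂, hσ₂, hus⟩ := ih hts
    refine ⟨fun v => if v ∈ t.varsList then σ₁ v else σ₂ v, fun v => ?_, ?_⟩
    · dsimp only
      split_ifs
      exacts [hσ₁ v, hσ₂ v]
    · rw [List.map_cons]
      refine .cons ?_ ?_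
      · rwa [Tm.subst_congr (η := σ₁) fun v hv => if_pos hv]
      · rwa [List.map_congr_left (g := Tm.subst σ₂)]
        refine fun s hs => Tm.subst_congr fun v hv => if_neg fun hvt => ?_
        exact hdisj hvt (List.mem_flatten_of_mem (List.mem_map_of_mem hs) hv)

/-- For every linear pattern `t`, image disjointness
together with pattern injectivity for `t` implies the pattern requirement for
`t`: for every substitution `σ` (mapping variables to ground terms, so that
`tσ` is ground) and every ground term `m`, if `γ(tσ) = γ(m)` then there
exists a substitution `σ'` with `m =_E tσ'`.

Here `γ : M → B` is the `Σ`-algebra homomorphism into the bytestring algebra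
(interpreting each `f ∈ Σ` as `interp f`), respecting `=_E` on ground terms;
`=_E` is an equivalence relation closed under contexts.  Image disjointness:
(i) `γ` is injective on the names and (ii) for distinct `f, g ∈ Σ` the image
of `f^B` meets neither the image of `g^B` nor `γ(N)`.  Pattern injectivity
for `t`: for every subterm `f(t'_1, …, t'_k)` of `t`, whenever
`f^B(γ(t'_1σ), …, γ(t'_kσ)) = f^B(b_1, …, b_k)` there is a substitution `σ'`
with `b_j = γ(t'_jσ')` for all `j`. -/
theorem pattern_requirement_of_image_disjointness_and_pattern_injectivity
    (Sig B : Type)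
    (eqE : Tm Sig → Tm Sig → Prop)
    (heqE : Equivalence eqE)
    (hcong : ∀ (f : Sig) (ts us : List (Tm Sig)),
      List.Forall₂ eqE ts us → eqE (.app f ts) (.app f us))
    (interp : Sig → List B → B)
    (γ : Tm Sig → B)
    (hhom : ∀ (f : Sig) (ts : List (Tm Sig)), γ (.app f ts) = interp f (ts.map γ))
    (hγE : ∀ u v : Tm Sig, u.IsGround → v.IsGround → eqE u v → γ u = γ v)
    -- image disjointness
    (hinjN : ∀ u v : Tm Sig, u.IsName → v.IsName → γ u = γ v → u = v)
    (hdisjF : ∀ f g : Sig, f ≠ g → ∀ bs cs : List B, interp f bs ≠ interp g cs)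
    (hdisjN : ∀ (f : Sig) (bs : List B) (u : Tm Sig), u.IsName → interp f bs ≠ γ u)
    -- the linear pattern
    (t : Tm Sig) (hlin : t.Linear)
    -- pattern injectivity for t
    (hpat : ∀ (f : Sig) (ts' : List (Tm Sig)), Subtm (.app f ts') t →
      ∀ σ : ℕ → Tm Sig, GroundSubst σ → ∀ bs : List B,
        interp f (ts'.map (fun u => γ (u.subst σ))) = interp f bs →
        ∃ σ' : ℕ → Tm Sig, GroundSubst σ' ∧ bs = ts'.map (fun u => γ (u.subst σ'))) :
    -- the pattern requirement for t
    ∀ σ : ℕ → Tm Sig, GroundSubst σ → ∀ m : Tm Sig, m.IsGround →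
      γ (t.subst σ) = γ m →
      ∃ σ' : ℕ → Tm Sig, GroundSubst σ' ∧ eqE m (t.subst σ') := by
  induction t using Tm.induction with
  | var v =>
    exact fun σ _ m hm _ => ⟨fun _ => m, fun _ => hm, by simpa [Tm.subst] using heqE.refl m⟩
  | frsh n =>
    intro σ hσ m hm h
    have hn : (Tm.frsh n : Tm Sig).IsName := .inl ⟨n, rfl⟩
    rw [Tm.subst] at h
    refine ⟨σ, hσ, ?_⟩
    rw [Tm.subst]
    cases hm with
    | frsh k => exact hinjN _ _ hn (.inl ⟨k, rfl⟩) h ▸ heqE.refl _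
    | pub k => exact hinjN _ _ hn (.inr ⟨k, rfl⟩) h ▸ heqE.refl _
    | app g us _ => exact absurd (hhom g us ▸ h.symm) (hdisjN _ _ _ hn)
  | pub n =>
    intro σ hσ m hm h
    have hn : (Tm.pub n : Tm Sig).IsName := .inr ⟨n, rfl⟩
    rw [Tm.subst] at h
    refine ⟨σ, hσ, ?_⟩
    rw [Tm.subst]
    cases hm with
    | frsh k => exact hinjN _ _ hn (.inl ⟨k, rfl⟩) h ▸ heqE.refl _
    | pub k => exact hinjN _ _ hn (.inr ⟨k, rfl⟩) h ▸ heqE.refl _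
    | app g us _ => exact absurd (hhom g us ▸ h.symm) (hdisjN _ _ _ hn)
  | app f ts ih =>
    intro σ hσ m hm h
    rw [Tm.subst_app, hhom] at h
    cases hm with
    | frsh k => exact absurd h (hdisjN _ _ _ (.inl ⟨k, rfl⟩))
    | pub k => exact absurd h (hdisjN _ _ _ (.inr ⟨k, rfl⟩))
    | app g us hus =>
      rw [hhom] at h
      obtain rfl : f = g := by
        by_contra hfg
        exact hdisjF f g hfg _ _ h
      rw [List.map_map] at h
      obtain ⟨τ, hτ, hγ⟩ := hpat f ts (.refl _) σ hσ _ h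
      rw [Tm.Linear, Tm.varsList_app] at hlin
      have hargs : List.Forall₂ (fun u t => ∃ σ', GroundSubst σ' ∧ eqE u (t.subst σ')) us ts := by
        have hmap : List.Forall₂ (fun u t => γ u = γ (t.subst τ)) us ts := by
          rwa [← List.forall₂_eq_eq_eq, List.forall₂_map_left_iff,
            List.forall₂_map_right_iff] at hγ
        rw [List.forall₂_iff_zip] at hmap ⊢
        refine ⟨hmap.1, fun {u t} hut => ?_⟩
        obtain ⟨hu, ht⟩ := List.of_mem_zip hut
        refine ih t ht ?_ (fun g vs hs => hpat g vs (.app ht hs)) τ hτ u (hus u hu)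
          (hmap.2 hut).symm
        exact (List.nodup_flatten.mp hlin).1 _ (List.mem_map_of_mem ht)
      obtain ⟨σ', hσ', hall⟩ := exists_groundSubst_forall₂ hlin hargs
      exact ⟨σ', hσ', by rw [Tm.subst_app]; exact hcong f _ _ hall⟩
end

section
/- Forward simulation implies filtered-trace inclusion: Let A (concrete) and B (abstract) be LTSs over a label set L with a distinguished silent label ε, initial states a0 and b0, and let R be a relation between states of B and states of A such that (b0, a0) ∈ R, and for every (b, a) ∈ R and every transition a --l--> a' of A there exist m ≥ 0, states b = c_0, …, c_m of B and labels l_1, …, l_m with c_{j-1} --l_j--> c_j in B for all j, (c_m, a') ∈ R, and the subsequence of non-ε labels of ⟨l_1,…,l_m⟩ equal to the subsequence of non-ε labels of ⟨l⟩ (i.e., equal to ⟨l⟩ if l ≠ ε and empty otherwise). Then Tr'(A) ⊆ Tr'(B), where Tr' denotes the set of traces with all ε labels deleted. -/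
open scoped Classical

/-- Finite executions of a labeled transition relation. -/
inductive Exec {σ L : Type} (step : σ → L → σ → Prop) : σ → List L → σ → Prop
  | nil (s : σ) : Exec step s [] s
  | cons {s a s' tr s''} : step s a s' → Exec step s' tr s'' → Exec step s (a :: tr) s''

/-- The set of traces of a transition relation from an initial state. -/
def TracesOf {σ L : Type} (step : σ → L → σ → Prop) (init : σ) : Set (List L) :=
  {tr | ∃ s', Exec step init tr s'}

/-- Deleting all occurrences of the silent label `ε` from a trace. -/
noncomputable def delEps {L : Type} (ε : L) : List L → List L
  | [] => []
  | a :: tr => if a = ε then delEps ε tr else a :: delEps ε tr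

/-- A labeled transition system over the label type `L`. -/
structure LTS (L : Type) where
  S : Type
  init : S
  step : S → L → S → Prop

/-- `Tr(A)`: the traces of an LTS. -/
def LTS.Tr {L : Type} (A : LTS L) : Set (List L) := TracesOf A.step A.init

/-- `Tr'(A)`: the traces of an LTS with all `ε` labels deleted. -/
noncomputable def LTS.Tr' {L : Type} (ε : L) (A : LTS L) : Set (List L) :=
  delEps ε '' A.Tr

/-- Relabeling an LTS by a function on labels. -/
def LTS.map {L L' : Type} (g : L → L') (A : LTS L) : LTS L' :=
  ⟨A.S, A.init, fun s l s' => ∃ l₀, A.step s l₀ s' ∧ l = g l₀⟩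

/-- The interleaving parallel composition `|||_{i∈I} A_i`: one component makes
a transition and all others are unchanged. -/
def interleave {I L : Type} (A : I → LTS L) : LTS L where
  S := ∀ i, (A i).S
  init := fun i => (A i).init
  step := fun s l s' => ∃ i, (A i).step (s i) l (s' i) ∧ ∀ j, j ≠ i → s' j = s j

/-- The synchronizing parallel composition `A ||_Λ B`: an `ε`-labeled
transition when `A` and `B` simultaneously make transitions with a common
label in `Λ`, and an `a`-labeled transition for `a ∉ Λ` when exactly one of
`A`, `B` makes an `a`-labeled transition. -/
def syncP {L : Type} (ε : L) (Λ : Set L) (A B : LTS L) : LTS L where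
  S := A.S × B.S
  init := (A.init, B.init)
  step := fun s l s' =>
    (l = ε ∧ ∃ a ∈ Λ, A.step s.1 a s'.1 ∧ B.step s.2 a s'.2) ∨
    (l ∉ Λ ∧ A.step s.1 l s'.1 ∧ s'.2 = s.2) ∨
    (l ∉ Λ ∧ B.step s.2 l s'.2 ∧ s'.1 = s.1)

theorem Exec.append {σ L : Type} {step : σ → L → σ → Prop} {s t u : σ} {xs ys : List L}
    (h₁ : Exec step s xs t) (h₂ : Exec step t ys u) : Exec step s (xs ++ ys) u := by
  induction h₁ with
  | nil => exact h₂
  | cons hstep _ ih => exact .cons hstep (ih h₂)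

theorem delEps_append {L : Type} (ε : L) (xs ys : List L) :
    delEps ε (xs ++ ys) = delEps ε xs ++ delEps ε ys := by
  induction xs with
  | nil => rfl
  | cons x xs ih =>
    simp only [List.cons_append, delEps, ih]
    split_ifs <;> rfl

/-- A forward simulation lifts every concrete execution to an abstract one with the same
non-silent labels. -/
theorem Exec.exists_of_simulation {σ τ L : Type} {ε : L} {stepA : σ → L → σ → Prop}
    {stepB : τ → L → τ → Prop} {R : τ → σ → Prop}
    (hsim : ∀ b a, R b a → ∀ l a', stepA a l a' →
      ∃ (ls : List L) (c : τ), Exec stepB b ls c ∧ R c a' ∧ delEps ε ls = delEps ε [l])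
    {a a' : σ} {tr : List L} (h : Exec stepA a tr a') {b : τ} (hR : R b a) :
    ∃ (ls : List L) (c : τ), Exec stepB b ls c ∧ R c a' ∧ delEps ε ls = delEps ε tr := by
  induction h generalizing b with
  | nil => exact ⟨[], b, .nil b, hR, rfl⟩
  | @cons _ l _ tr _ hstep _ ih =>
    obtain ⟨xs, c, hxs, hc, hxs_eq⟩ := hsim _ _ hR _ _ hstep
    obtain ⟨ys, d, hys, hd, hys_eq⟩ := ih hc
    refine ⟨xs ++ ys, d, hxs.append hys, hd, ?_⟩
    rw [delEps_append, hxs_eq, hys_eq, ← delEps_append, List.singleton_append]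

/-- Forward simulation implies filtered-trace inclusion:
let `A` (concrete) and `B` (abstract) be LTSs over a label set `L` with a
distinguished silent label `ε`, and let `R` be a relation between states of
`B` and states of `A` such that `(B.init, A.init) ∈ R`, and every concrete
transition from an `R`-related pair is matched by a finite abstract execution
ending in an `R`-related state whose non-`ε` labels coincide with the non-`ε`
labels of the concrete transition.  Then `Tr'(A) ⊆ Tr'(B)`. -/
theorem forward_simulation_implies_filtered_trace_inclusion
    {L : Type} (ε : L) (A B : LTS L)
    (R : B.S → A.S → Prop)
    (hinit : R B.init A.init)
    (hsim : ∀ b a, R b a → ∀ l a', A.step a l a' →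
      ∃ (ls : List L) (c : B.S), Exec B.step b ls c ∧ R c a' ∧
        delEps ε ls = delEps ε [l]) :
    LTS.Tr' ε A ⊆ LTS.Tr' ε B := by
  rintro _ ⟨tr, ⟨a, h⟩, rfl⟩
  obtain ⟨ls, c, hls, -, heq⟩ := h.exists_of_simulation hsim hinit
  exact ⟨ls, ⟨c, hls⟩, heq⟩
end

section
/- Trace inclusion is compositional for interleaving and synchronizing parallel composition: let (A_i)_{i∈I} and (B_i)_{i∈I} be families of LTSs over a label set L indexed by the same set I, let A and B be LTSs over L, and let Λ ⊆ L. If Tr(A_i) ⊆ Tr(B_i) for every i ∈ I and Tr(A) ⊆ Tr(B), then Tr((|||_{i∈I} A_i) ||_Λ A) ⊆ Tr((|||_{i∈I} B_i) ||_Λ B). -/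
open scoped Classical

theorem Exec.eq_of_nil {σ L : Type} {step : σ → L → σ → Prop} {s s' : σ}
    (h : Exec step s [] s') : s = s' := by
  cases h
  rfl

/-- `tr` is an interleaving of the family `t` of words, of which only finitely many are nonempty. -/
inductive IsInterleaving {I L : Type} : (I → List L) → List L → Prop
  | nil : IsInterleaving (fun _ => []) []
  | cons {t : I → List L} {tr : List L} (i : I) (a : L) :
      IsInterleaving t tr → IsInterleaving (Function.update t i (a :: t i)) (a :: tr)

/-- `w` is obtained from `u` and `v` by synchronizing on `Λ`, and interleaving off `Λ`. -/
inductive IsSync {L : Type} (ε : L) (Λ : Set L) : List L → List L → List L → Prop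
  | nil : IsSync ε Λ [] [] []
  | sync {a : L} {u v w : List L} :
      a ∈ Λ → IsSync ε Λ u v w → IsSync ε Λ (a :: u) (a :: v) (ε :: w)
  | left {a : L} {u v w : List L} : a ∉ Λ → IsSync ε Λ u v w → IsSync ε Λ (a :: u) v (a :: w)
  | right {a : L} {u v w : List L} : a ∉ Λ → IsSync ε Λ u v w → IsSync ε Λ u (a :: v) (a :: w)

theorem exists_isInterleaving_of_exec {I L : Type} {A : I → LTS L} {s s' : ∀ i, (A i).S}
    {tr : List L} (h : Exec (interleave A).step s tr s') :
    ∃ t, IsInterleaving t tr ∧ ∀ i, Exec (A i).step (s i) (t i) (s' i) := by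
  induction h with
  | nil s => exact ⟨_, .nil, fun i => .nil (s i)⟩
  | @cons s a s₁ tr s₂ hstep _ ih =>
    obtain ⟨t, ht, hexec⟩ := ih
    obtain ⟨i, hi, hne⟩ := hstep
    refine ⟨_, .cons i a ht, fun j => ?_⟩
    by_cases hj : j = i
    · subst hj
      simpa using Exec.cons hi (hexec j)
    · simpa [hj, hne j hj] using hexec j

theorem IsInterleaving.exec {I L : Type} {A : I → LTS L} {t : I → List L} {tr : List L}
    (h : IsInterleaving t tr) {s s' : ∀ i, (A i).S}
    (hexec : ∀ i, Exec (A i).step (s i) (t i) (s' i)) :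
    Exec (interleave A).step s tr s' := by
  induction h generalizing s with
  | nil =>
    have hs : s = s' := funext fun i => (hexec i).eq_of_nil
    exact hs ▸ .nil s
  | @cons t tr i a _ ih =>
    have hi := hexec i
    rw [Function.update_self] at hi
    cases hi with
    | @cons _ _ x _ _ hstep htail =>
      refine .cons (s' := Function.update s i x)
        ⟨i, by simpa using hstep, fun j hj => by simp [hj]⟩ (ih fun j => ?_)
      by_cases hj : j = i
      · subst hj
        simpa using htail
      · simpa [hj] using hexec j

theorem exists_isSync_of_exec {L : Type} {ε : L} {Λ : Set L} {A B : LTS L} {s s' : A.S × B.S}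
    {w : List L} (h : Exec (syncP ε Λ A B).step s w s') :
    ∃ u v, IsSync ε Λ u v w ∧ Exec A.step s.1 u s'.1 ∧ Exec B.step s.2 v s'.2 := by
  induction h with
  | nil s => exact ⟨_, _, .nil, .nil _, .nil _⟩
  | cons hstep _ ih =>
    obtain ⟨u, v, hw, hu, hv⟩ := ih
    obtain ⟨rfl, a, ha, hA, hB⟩ | ⟨ha, hA, hB⟩ | ⟨ha, hB, hA⟩ := hstep
    · exact ⟨_, _, .sync ha hw, .cons hA hu, .cons hB hv⟩
    · exact ⟨_, _, .left ha hw, .cons hA hu, hB ▸ hv⟩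
    · exact ⟨_, _, .right ha hw, hA ▸ hu, .cons hB hv⟩

theorem IsSync.exec {L : Type} {ε : L} {Λ : Set L} {A B : LTS L} {u v w : List L}
    (h : IsSync ε Λ u v w) {p p' : A.S} {q q' : B.S}
    (hu : Exec A.step p u p') (hv : Exec B.step q v q') :
    Exec (syncP ε Λ A B).step (p, q) w (p', q') := by
  induction h generalizing p q with
  | nil =>
    cases hu
    cases hv
    exact .nil _
  | sync ha _ ih =>
    cases hu with
    | cons hA hu =>
      cases hv with
      | cons hB hv => exact .cons (.inl ⟨rfl, _, ha, hA, hB⟩) (ih hu hv)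
  | left ha _ ih =>
    cases hu with
    | cons hA hu => exact .cons (s' := (_, q)) (.inr (.inl ⟨ha, hA, rfl⟩)) (ih hu hv)
  | right ha _ ih =>
    cases hv with
    | cons hB hv => exact .cons (s' := (p, _)) (.inr (.inr ⟨ha, hB, rfl⟩)) (ih hu hv)

theorem interleave_Tr_mono {I L : Type} {A B : I → LTS L} (h : ∀ i, (A i).Tr ⊆ (B i).Tr) :
    (interleave A).Tr ⊆ (interleave B).Tr := by
  rintro tr ⟨s', hs'⟩
  obtain ⟨t, ht, hexec⟩ := exists_isInterleaving_of_exec hs'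
  choose r hr using fun i => h i ⟨s' i, hexec i⟩
  exact ⟨r, ht.exec hr⟩

theorem syncP_Tr_mono {L : Type} {ε : L} {Λ : Set L} {A A' B B' : LTS L}
    (hA : A.Tr ⊆ A'.Tr) (hB : B.Tr ⊆ B'.Tr) :
    (syncP ε Λ A B).Tr ⊆ (syncP ε Λ A' B').Tr := by
  rintro w ⟨s', hs'⟩
  obtain ⟨u, v, hw, hu, hv⟩ := exists_isSync_of_exec hs'
  obtain ⟨p, hp⟩ := hA ⟨_, hu⟩
  obtain ⟨q, hq⟩ := hB ⟨_, hv⟩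
  exact ⟨(p, q), hw.exec hp hq⟩

/-- Trace inclusion is compositional for interleaving and
synchronizing parallel composition: let `(A_i)` and `(B_i)` be families of
LTSs over `L` indexed by the same set `I`, let `A` and `B` be LTSs over `L`,
and let `Λ ⊆ L`.  If `Tr(A_i) ⊆ Tr(B_i)` for every `i` and `Tr(A) ⊆ Tr(B)`,
then `Tr((|||_i A_i) ||_Λ A) ⊆ Tr((|||_i B_i) ||_Λ B)`. -/
theorem trace_inclusion_compositional
    {I L : Type} (ε : L) (Λ : Set L)
    (Af Bf : I → LTS L) (A B : LTS L)
    (hfam : ∀ i, (Af i).Tr ⊆ (Bf i).Tr)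
    (hAB : A.Tr ⊆ B.Tr) :
    (syncP ε Λ (interleave Af) A).Tr ⊆ (syncP ε Λ (interleave Bf) B).Tr :=
  syncP_Tr_mono (interleave_Tr_mono hfam) hAB
end

section
/- Pushing a relabeling into a parallel composition changes the synchronization set by inverse image: let (A_i)_{i∈I} and B be LTSs over a label set L with silent label ε, let Λ ⊆ L, let g : L → L satisfy g(ε) = ε, and set Λ' = g⁻¹(Λ). If g(a) = a for every label a ∉ Λ', then Tr((|||_{i∈I} A_i) ||_{Λ'} B) ⊆ Tr((|||_{i∈I} g(A_i)) ||_Λ g(B)). -/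
open scoped Classical

theorem Exec.mono {σ L : Type} {step step' : σ → L → σ → Prop}
    (h : ∀ s a s', step s a s' → step' s a s') {s s' : σ} {tr : List L}
    (he : Exec step s tr s') : Exec step' s tr s' := by
  induction he with
  | nil s => exact .nil s
  | cons hs _ ih => exact .cons (h _ _ _ hs) ih

theorem LTS.map_step {L L' : Type} (g : L → L') {A : LTS L} {s s' : A.S} {a : L}
    (h : A.step s a s') : (A.map g).step s (g a) s' :=
  ⟨a, h, rfl⟩

theorem interleave_map_step {I L L' : Type} (g : L → L') {A : I → LTS L}
    {s s' : (interleave A).S} {a : L} (h : (interleave A).step s a s') :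
    (interleave fun i => (A i).map g).step s (g a) s' :=
  let ⟨i, hi, hj⟩ := h
  ⟨i, LTS.map_step g hi, hj⟩

/-- Pushing a relabeling into a parallel composition
changes the synchronization set by inverse image: let `(A_i)` and `B` be LTSs
over `L` with silent label `ε`, let `Λ ⊆ L`, let `g : L → L` satisfy
`g(ε) = ε`, and set `Λ' = g⁻¹(Λ)`.  If `g(a) = a` for every label `a ∉ Λ'`,
then `Tr((|||_i A_i) ||_{Λ'} B) ⊆ Tr((|||_i g(A_i)) ||_Λ g(B))`. -/
theorem relabeling_pushed_into_composition
    {I L : Type} (ε : L) (Λ : Set L) (g : L → L)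
    (Af : I → LTS L) (B : LTS L)
    (hgε : g ε = ε)
    (hfix : ∀ a, a ∉ g ⁻¹' Λ → g a = a) :
    (syncP ε (g ⁻¹' Λ) (interleave Af) B).Tr ⊆
      (syncP ε Λ (interleave (fun i => (Af i).map g)) (B.map g)).Tr := by
  rintro tr ⟨s', he⟩
  refine ⟨s', Exec.mono ?_ he⟩
  have hfix' : ∀ a, a ∉ g ⁻¹' Λ → a ∉ Λ ∧ g a = a := fun a ha =>
    ⟨fun h => ha (by rwa [Set.mem_preimage, hfix a ha]), hfix a ha⟩
  rintro s l t (⟨hl, a, ha, hA, hB⟩ | ⟨hl, hA, ht⟩ | ⟨hl, hB, ht⟩)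
  · exact .inl ⟨hl, g a, ha, interleave_map_step g hA, LTS.map_step g hB⟩
  · obtain ⟨hl', hg⟩ := hfix' l hl
    have hA' := interleave_map_step g hA
    rw [hg] at hA'
    exact .inr (.inl ⟨hl', hA', ht⟩)
  · obtain ⟨hl', hg⟩ := hfix' l hl
    have hB' := LTS.map_step g hB
    rw [hg] at hB'
    exact .inr (.inr ⟨hl', hB', ht⟩)
end
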